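/- arXiv:2304.03196 — 2 statements merged into one kernel-verified Lean document; each statement's English description precedes it below -/
import Mathlib

section
/- For every natural number n, the balanced presentation with two generators x, y and relators (x⁻¹(yx⁻¹)ⁿy⁻¹(y⁻¹x)ⁿy, x⁻¹(yx⁻¹)ⁿy⁻¹(xy⁻¹)ⁿ) is AC-equivalent to the presentation with relators (y⁻²x⁻¹, (yx⁻¹)ⁿ(y⁻¹x)ⁿy⁻¹x⁻¹). -/
/-- Andrews-Curtis moves (1)-(4) on balanced presentations, where a balanced
presentation with `n` generators is a tuple of `n` relators in `FreeGroup (Fin n)`.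
`inv` is move (1), `mul` is move (2), `conj`/`conjInv` are move (3) (conjugation by a
generator or its inverse), and `stab`/`destab` are the two directions of move (4). -/
inductive ACMove :
    (Σ n : ℕ, Fin n → FreeGroup (Fin n)) → (Σ n : ℕ, Fin n → FreeGroup (Fin n)) → Prop
  | inv (n : ℕ) (r : Fin n → FreeGroup (Fin n)) (i : Fin n) :
      ACMove ⟨n, r⟩ ⟨n, Function.update r i (r i)⁻¹⟩
  | mul (n : ℕ) (r : Fin n → FreeGroup (Fin n)) (i j : Fin n) (hij : i ≠ j) :
      ACMove ⟨n, r⟩ ⟨n, Function.update r i (r i * r j)⟩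
  | conj (n : ℕ) (r : Fin n → FreeGroup (Fin n)) (i j : Fin n) :
      ACMove ⟨n, r⟩ ⟨n, Function.update r i (FreeGroup.of j * r i * (FreeGroup.of j)⁻¹)⟩
  | conjInv (n : ℕ) (r : Fin n → FreeGroup (Fin n)) (i j : Fin n) :
      ACMove ⟨n, r⟩ ⟨n, Function.update r i ((FreeGroup.of j)⁻¹ * r i * FreeGroup.of j)⟩
  | stab (n : ℕ) (r : Fin n → FreeGroup (Fin n)) :
      ACMove ⟨n, r⟩
        ⟨n + 1, Fin.snoc (fun i => FreeGroup.map Fin.castSucc (r i)) (FreeGroup.of (Fin.last n))⟩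
  | destab (n : ℕ) (r : Fin n → FreeGroup (Fin n)) :
      ACMove
        ⟨n + 1, Fin.snoc (fun i => FreeGroup.map Fin.castSucc (r i)) (FreeGroup.of (Fin.last n))⟩
        ⟨n, r⟩

/-- Two balanced presentations are AC-equivalent if they are related by a finite
sequence of Andrews-Curtis moves (1)-(4). -/
def ACEquiv (P Q : Σ n : ℕ, Fin n → FreeGroup (Fin n)) : Prop :=
  Relation.ReflTransGen ACMove P Q

/-- A balanced presentation is AC-trivial if it can be converted to the trivial
presentation `(x_1, …, x_n)` by a finite sequence of moves (1)-(4). -/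
def ACTrivial {n : ℕ} (r : Fin n → FreeGroup (Fin n)) : Prop :=
  ACEquiv ⟨n, r⟩ ⟨n, fun i => FreeGroup.of i⟩

/-- The first generator `x` of the free group `F_2` on two generators. -/
def x : FreeGroup (Fin 2) := FreeGroup.of 0

/-- The second generator `y` of the free group `F_2` on two generators. -/
def y : FreeGroup (Fin 2) := FreeGroup.of 1

theorem ac_upd0 (a b c : FreeGroup (Fin 2)) : Function.update ![a, b] 0 c = ![c, b] := by
  ext i
  fin_cases i <;> simp

theorem ac_upd1 (a b c : FreeGroup (Fin 2)) : Function.update ![a, b] 1 c = ![a, c] := by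
  ext i
  fin_cases i <;> simp

theorem ac_inv0 (a b : FreeGroup (Fin 2)) : ACEquiv ⟨2, ![a, b]⟩ ⟨2, ![a⁻¹, b]⟩ := by
  have h := ACMove.inv 2 ![a, b] 0
  rw [ac_upd0] at h
  exact Relation.ReflTransGen.single h

theorem ac_inv1 (a b : FreeGroup (Fin 2)) : ACEquiv ⟨2, ![a, b]⟩ ⟨2, ![a, b⁻¹]⟩ := by
  have h := ACMove.inv 2 ![a, b] 1
  rw [ac_upd1] at h
  exact Relation.ReflTransGen.single h

theorem ac_mul0 (a b : FreeGroup (Fin 2)) : ACEquiv ⟨2, ![a, b]⟩ ⟨2, ![a * b, b]⟩ := by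
  have h := ACMove.mul 2 ![a, b] 0 1 (by decide)
  rw [ac_upd0] at h
  exact Relation.ReflTransGen.single h

theorem ac_mul1 (a b : FreeGroup (Fin 2)) : ACEquiv ⟨2, ![a, b]⟩ ⟨2, ![a, b * a]⟩ := by
  have h := ACMove.mul 2 ![a, b] 1 0 (by decide)
  rw [ac_upd1] at h
  exact Relation.ReflTransGen.single h

theorem ac_conj0 (a b : FreeGroup (Fin 2)) :
    ACEquiv ⟨2, ![a, b]⟩ ⟨2, ![x * a * x⁻¹, b]⟩ := by
  have h := ACMove.conj 2 ![a, b] 0 0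
  rw [ac_upd0] at h
  exact Relation.ReflTransGen.single h

theorem ac_conjInv0 (a b : FreeGroup (Fin 2)) :
    ACEquiv ⟨2, ![a, b]⟩ ⟨2, ![x⁻¹ * a * x, b]⟩ := by
  have h := ACMove.conjInv 2 ![a, b] 0 0
  rw [ac_upd0] at h
  exact Relation.ReflTransGen.single h

theorem pow_key {G : Type*} [Group G] (x y : G) (n : ℕ) :
    (y⁻¹ * x) ^ n = y⁻¹ * (x * y⁻¹) ^ n * y := by
  have h := conj_pow (i := n) (a := y⁻¹) (b := x * y⁻¹)
  rw [inv_inv] at h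
  rw [← h]
  congr 1
  group

theorem pow_key2 {G : Type*} [Group G] (x y : G) (n : ℕ) :
    (y * x⁻¹) ^ n = ((x * y⁻¹) ^ n)⁻¹ := by
  rw [← inv_pow]
  congr 1
  group

theorem ac_trans {P Q R : Σ n : ℕ, Fin n → FreeGroup (Fin n)}
    (h : ACEquiv P Q) (k : ACEquiv Q R) : ACEquiv P R := Relation.ReflTransGen.trans h k

theorem acEquiv_4n1 (n : ℕ) :
    ACEquiv ⟨2, ![x⁻¹ * (y * x⁻¹) ^ n * y⁻¹ * (y⁻¹ * x) ^ n * y,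
      x⁻¹ * (y * x⁻¹) ^ n * y⁻¹ * (x * y⁻¹) ^ n]⟩
      ⟨2, ![(y ^ 2)⁻¹ * x⁻¹, (y * x⁻¹) ^ n * (y⁻¹ * x) ^ n * y⁻¹ * x⁻¹]⟩ := by
  rw [pow_key, pow_key2]
  generalize (x * y⁻¹) ^ n = c
  refine ac_trans (ac_inv1 _ _) ?_
  refine ac_trans (ac_mul1 _ _) ?_
  refine ac_trans (ac_conj0 _ _) ?_
  refine ac_trans (ac_inv0 _ _) ?_
  refine ac_trans (ac_mul0 _ _) ?_
  refine ac_trans (ac_conjInv0 _ _) ?_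
  refine ac_trans (ac_inv0 _ _) ?_
  refine ac_trans (ac_inv1 _ _) ?_
  refine ac_trans (ac_mul0 _ _) ?_
  refine ac_trans (ac_conj0 _ _) ?_
  refine ac_trans (ac_inv1 _ _) ?_
  refine ac_trans (ac_mul1 _ _) ?_
  have e : ∀ a b a' b' : FreeGroup (Fin 2), a = a' → b = b' →
      ACEquiv ⟨2, ![a, b]⟩ ⟨2, ![a', b']⟩ := by
    rintro a b _ _ rfl rfl
    exact Relation.ReflTransGen.refl
  apply e
  · simp [pow_two, mul_assoc]
  · simp [pow_two, mul_assoc]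
end

section
/- For every natural number n, the balanced presentation with two generators x, y and relators (y⁻¹(x⁻¹y⁻¹x⁻¹)ⁿ(yx²)ⁿyx, x⁻¹(y⁻¹x⁻²)ⁿy⁻¹x⁻¹y⁻¹(xyx)ⁿxy) is AC-equivalent to the presentation with relators ((x⁻¹y⁻¹x⁻¹)ⁿyx(xyx)ⁿy⁻¹, y⁻¹x). -/
theorem ac_mul (r s : FreeGroup (Fin 2)) : ACEquiv ⟨2, ![r, s]⟩ ⟨2, ![r, s * r]⟩ := by
  have h := ACMove.mul 2 ![r, s] 1 0 (by decide)
  have e : Function.update ![r, s] 1 (![r, s] 1 * ![r, s] 0) = ![r, s * r] := by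
    ext i; fin_cases i <;> simp
  rw [e] at h
  exact Relation.ReflTransGen.single h

theorem ac_conj (i : Fin 2) (w : FreeGroup (Fin 2)) (r : Fin 2 → FreeGroup (Fin 2)) :
    ACEquiv ⟨2, r⟩ ⟨2, Function.update r i (w * r i * w⁻¹)⟩ := by
  induction w using FreeGroup.induction_on generalizing r with
  | C1 => simpa [ACEquiv] using Relation.ReflTransGen.refl
  | of j => exact Relation.ReflTransGen.single (ACMove.conj 2 r i j)
  | inv_of j _ =>
    have h := ACMove.conjInv 2 r i j
    rw [inv_inv]
    exact Relation.ReflTransGen.single h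
  | mul a b ha hb =>
    have h := Relation.ReflTransGen.trans (hb r) (ha _)
    simp only [Function.update_self, Function.update_idem] at h
    have e : a * b * r i * (a * b)⁻¹ = a * (b * r i * b⁻¹) * a⁻¹ := by group
    rw [e]
    exact h

theorem ac_conj0_s17 (w r s t : FreeGroup (Fin 2)) (h : w * r * w⁻¹ = t) :
    ACEquiv ⟨2, ![r, s]⟩ ⟨2, ![t, s]⟩ := by
  have h1 := ac_conj 0 w ![r, s]
  have e : Function.update ![r, s] 0 (w * ![r, s] 0 * w⁻¹) = ![t, s] := by
    ext i; fin_cases i <;> simp [h]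
  rwa [e] at h1

theorem ac_conj1 (w r s t : FreeGroup (Fin 2)) (h : w * s * w⁻¹ = t) :
    ACEquiv ⟨2, ![r, s]⟩ ⟨2, ![r, t]⟩ := by
  have h1 := ac_conj 1 w ![r, s]
  have e : Function.update ![r, s] 1 (w * ![r, s] 1 * w⁻¹) = ![r, t] := by
    ext i; fin_cases i <;> simp [h]
  rwa [e] at h1

theorem ac_chain (r s : FreeGroup (Fin 2)) (h : y * s * y⁻¹ = r⁻¹ * y⁻¹ * r⁻¹ * x) :
    ACEquiv ⟨2, ![r, s]⟩ ⟨2, ![r, y⁻¹ * x]⟩ := by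
  have h1 : ACEquiv ⟨2, ![r, s]⟩ ⟨2, ![r, y⁻¹ * r⁻¹ * x * r⁻¹]⟩ :=
    ac_conj1 (r * y) _ _ _ (by
      have : r * y * s * (r * y)⁻¹ = r * (y * s * y⁻¹) * r⁻¹ := by group
      rw [this, h]; group)
  have h2 := ac_mul r (y⁻¹ * r⁻¹ * x * r⁻¹)
  have h3 : ACEquiv ⟨2, ![r, y⁻¹ * r⁻¹ * x * r⁻¹ * r]⟩ ⟨2, ![r, x * y⁻¹ * r⁻¹]⟩ :=
    ac_conj1 x _ _ _ (by group)
  have h4 := ac_mul r (x * y⁻¹ * r⁻¹)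
  have h5 : ACEquiv ⟨2, ![r, x * y⁻¹ * r⁻¹ * r]⟩ ⟨2, ![r, y⁻¹ * x]⟩ :=
    ac_conj1 y⁻¹ _ _ _ (by group)
  exact (((h1.trans h2).trans h3).trans h4).trans h5

/-- The presentation with relators `(y⁻¹(x⁻¹y⁻¹x⁻¹)ⁿ(yx²)ⁿyx,
x⁻¹(y⁻¹x⁻²)ⁿy⁻¹x⁻¹y⁻¹(xyx)ⁿxy)` is AC-equivalent to the presentation with relators
`((x⁻¹y⁻¹x⁻¹)ⁿyx(xyx)ⁿy⁻¹, y⁻¹x)`. -/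
theorem acEquiv_4n3 (n : ℕ) :
    ACEquiv ⟨2, ![y⁻¹ * (x⁻¹ * y⁻¹ * x⁻¹) ^ n * (y * x ^ 2) ^ n * y * x,
      x⁻¹ * (y⁻¹ * (x ^ 2)⁻¹) ^ n * y⁻¹ * x⁻¹ * y⁻¹ * (x * y * x) ^ n * x * y]⟩
      ⟨2, ![(x⁻¹ * y⁻¹ * x⁻¹) ^ n * y * x * (x * y * x) ^ n * y⁻¹, y⁻¹ * x]⟩ := by
  have e1 : (y * x ^ 2) ^ n = x⁻¹ * (x * y * x) ^ n * x := by
    have := conj_pow (i := n) (a := x⁻¹) (b := x * y * x)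
    rw [inv_inv] at this
    rw [← this]; congr 1; simp [pow_two, mul_assoc]
  have e2 : (y⁻¹ * (x ^ 2)⁻¹) ^ n = x * ((x * y * x) ^ n)⁻¹ * x⁻¹ := by
    rw [← inv_pow (x * y * x), ← conj_pow]; congr 1; simp [pow_two, mul_assoc]
  have e3 : (x⁻¹ * y⁻¹ * x⁻¹) ^ n = ((x * y * x) ^ n)⁻¹ := by
    rw [← inv_pow (x * y * x)]; congr 1
  have e4 : (x * y * x) ^ n * (x * y * x) = (x * y * x) * (x * y * x) ^ n :=
    (pow_mul_comm' _ _)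
  rw [e1, e2, e3]
  generalize (x * y * x) ^ n = u at e4
  have e5 : u * x * y * x = x * y * x * u := by simpa only [mul_assoc] using e4
  refine Relation.ReflTransGen.trans (ac_conj0_s17 y _ _ (u⁻¹ * y * x * u * y⁻¹) ?_)
    (ac_chain _ _ ?_)
  · calc _ = u⁻¹ * x⁻¹ * (u * x * y * x) * y⁻¹ := by group
      _ = _ := by rw [e5]; group
  · group
end
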